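/- Let H be a weak Hopf algebra over k and A|B a weak H-Galois extension. Then A|B is left and right depth two: with n = dim_k H, the A-B-bimodule A⊗_B A (a ∈ A acting by left multiplication on the left tensorand, b ∈ B by right multiplication on the right tensorand) is isomorphic to a direct summand of the A-B-bimodule A^n (direct sum of n copies of A), and likewise the B-A-bimodule A⊗_B A is isomorphic to a direct summand of the B-A-bimodule A^n. -/

import Mathlib

noncomputable section

open TensorProduct LinearMap

/-- A weak bialgebra over a field `k`: a finite-dimensional `k`-algebra with a `k`-coalgebra
structure whose comultiplication is multiplicative, with the weakened unit and counit axioms. -/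
structure WeakBialgebra (k : Type*) [Field k] (H : Type*) [Ring H] [Algebra k H]
    [FiniteDimensional k H] where
  comul : H →ₗ[k] H ⊗[k] H
  counit : H →ₗ[k] k
  coassoc : ∀ x : H,
    (TensorProduct.assoc k H H H) ((rTensor H comul) (comul x)) = (lTensor H comul) (comul x)
  rTensor_counit_comul : ∀ x : H, (TensorProduct.lid k H) ((rTensor H counit) (comul x)) = x
  lTensor_counit_comul : ∀ x : H, (TensorProduct.rid k H) ((lTensor H counit) (comul x)) = x
  comul_mul : ∀ a b : H, comul (a * b) = comul a * comul b
  -- `1₍₁₎ ⊗ 1₍₂₎ ⊗ 1₍₃₎ = (Δ(1) ⊗ 1)(1 ⊗ Δ(1)) = (1 ⊗ Δ(1))(Δ(1) ⊗ 1)`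
  weak_one₁ : (lTensor H comul) (comul 1)
    = (TensorProduct.assoc k H H H) ((comul 1) ⊗ₜ[k] (1 : H)) * ((1 : H) ⊗ₜ[k] (comul 1))
  weak_one₂ : (lTensor H comul) (comul 1)
    = ((1 : H) ⊗ₜ[k] (comul 1)) * (TensorProduct.assoc k H H H) ((comul 1) ⊗ₜ[k] (1 : H))
  -- `ε(abc) = ε(ab₍₁₎)ε(b₍₂₎c) = ε(ab₍₂₎)ε(b₍₁₎c)`
  weak_counit₁ : ∀ a b c : H, counit (a * b * c)
    = (LinearMap.mul' k k)
        ((TensorProduct.map (counit ∘ₗ mulLeft k a) (counit ∘ₗ mulRight k c)) (comul b))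
  weak_counit₂ : ∀ a b c : H, counit (a * b * c)
    = (LinearMap.mul' k k)
        ((TensorProduct.map (counit ∘ₗ mulRight k c) (counit ∘ₗ mulLeft k a)) (comul b))

namespace WeakBialgebra

variable {k : Type*} [Field k] {H : Type*} [Ring H] [Algebra k H] [FiniteDimensional k H]
variable (wb : WeakBialgebra k H)

/-- `ε ⊗ id : H ⊗ H → H`. -/
def εid : H ⊗[k] H →ₗ[k] H := (TensorProduct.lid k H).toLinearMap ∘ₗ rTensor H wb.counit

/-- `id ⊗ ε : H ⊗ H → H`. -/
def idε : H ⊗[k] H →ₗ[k] H := (TensorProduct.rid k H).toLinearMap ∘ₗ lTensor H wb.counit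

/-- `Π^L(x) = ε(1₍₁₎x) 1₍₂₎`. -/
def projL : H →ₗ[k] H :=
  wb.εid ∘ₗ mulLeft k (wb.comul 1) ∘ₗ (TensorProduct.mk k H H).flip 1

/-- `Π^R(x) = 1₍₁₎ ε(x1₍₂₎)`. -/
def projR : H →ₗ[k] H :=
  wb.idε ∘ₗ mulRight k (wb.comul 1) ∘ₗ TensorProduct.mk k H H 1

/-- `Π̄^L(x) = 1₍₁₎ ε(1₍₂₎x)`. -/
def projBarL : H →ₗ[k] H :=
  wb.idε ∘ₗ mulLeft k (wb.comul 1) ∘ₗ TensorProduct.mk k H H 1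

/-- `Π̄^R(x) = ε(x1₍₁₎) 1₍₂₎`. -/
def projBarR : H →ₗ[k] H :=
  wb.εid ∘ₗ mulRight k (wb.comul 1) ∘ₗ (TensorProduct.mk k H H).flip 1

/-- The antipode axioms for a weak Hopf algebra: `S(x₍₁₎)x₍₂₎ = Π^R(x)`,
`x₍₁₎S(x₍₂₎) = Π^L(x)` and `S(x₍₁₎)x₍₂₎S(x₍₃₎) = S(x)`. -/
structure IsAntipode (S : H →ₗ[k] H) : Prop where
  antipode_left : ∀ x : H, LinearMap.mul' k H ((rTensor H S) (wb.comul x)) = wb.projR x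
  antipode_right : ∀ x : H, LinearMap.mul' k H ((lTensor H S) (wb.comul x)) = wb.projL x
  antipode_mid : ∀ x : H,
    LinearMap.mul' k H
      ((TensorProduct.map (LinearMap.mul' k H ∘ₗ rTensor H S) S)
        ((rTensor H wb.comul) (wb.comul x))) = S x

end WeakBialgebra

/-- A right `H`-comodule algebra over a weak bialgebra `H`. -/
structure ComodAlg {k : Type*} [Field k] {H : Type*} [Ring H] [Algebra k H]
    [FiniteDimensional k H] (wb : WeakBialgebra k H)
    (A : Type*) [Ring A] [Algebra k A] where
  ρ : A →ₗ[k] A ⊗[k] H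
  coassoc : ∀ a : A,
    (TensorProduct.assoc k A H H) ((rTensor H ρ) (ρ a)) = (lTensor A wb.comul) (ρ a)
  counital : ∀ a : A, (TensorProduct.rid k A) ((lTensor A wb.counit) (ρ a)) = a
  mul : ∀ a b : A, ρ (a * b) = ρ a * ρ b
  piL : ∀ a : A, (lTensor A wb.projL) (ρ a) = ρ 1 * (a ⊗ₜ[k] (1 : H))
  pibarR : ∀ a : A, (lTensor A wb.projBarR) (ρ a) = (a ⊗ₜ[k] (1 : H)) * ρ 1

namespace ComodAlg

variable {k : Type*} [Field k] {H : Type*} [Ring H] [Algebra k H] [FiniteDimensional k H]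
variable {wb : WeakBialgebra k H} {A : Type*} [Ring A] [Algebra k A]

/-- The coinvariant subalgebra `B = {b ∈ A : ρ(b) = 1₍₀₎b ⊗ 1₍₁₎}`. -/
def coinv (ca : ComodAlg wb A) : Set A := {b | ca.ρ b = ca.ρ 1 * (b ⊗ₜ[k] (1 : H))}

/-- The `B`-balancing relations in `A ⊗_k A`, realizing `A ⊗_B A`. -/
def rel (ca : ComodAlg wb A) : Submodule k (A ⊗[k] A) :=
  Submodule.span k
    {z | ∃ a a' b : A, b ∈ ca.coinv ∧ z = (a * b) ⊗ₜ[k] a' - a ⊗ₜ[k] (b * a')}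

/-- `A ⊗_B A`. -/
abbrev QA (ca : ComodAlg wb A) := (A ⊗[k] A) ⧸ ca.rel

/-- The canonical quotient map `A ⊗_k A → A ⊗_B A`. -/
def mkA (ca : ComodAlg wb A) : A ⊗[k] A →ₗ[k] ca.QA := ca.rel.mkQ

end ComodAlg

namespace ComodAlg

variable {k : Type*} [Field k] {H : Type*} [Ring H] [Algebra k H] [FiniteDimensional k H]
variable {wb : WeakBialgebra k H} {A : Type*} [Ring A] [Algebra k A]

theorem lmulA_aux (ca : ComodAlg wb A) (c : A) :
    ca.rel ≤ ca.rel.comap (rTensor A (mulLeft k c)) := by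
  rw [rel, Submodule.span_le]
  rintro z ⟨a, a', b, hb, rfl⟩
  simp only [SetLike.mem_coe, Submodule.mem_comap, map_sub, rTensor_tmul, mulLeft_apply]
  rw [← mul_assoc]
  exact Submodule.subset_span ⟨c * a, a', b, hb, rfl⟩

theorem rmulA_aux (ca : ComodAlg wb A) (c : A) :
    ca.rel ≤ ca.rel.comap (lTensor A (mulRight k c)) := by
  rw [rel, Submodule.span_le]
  rintro z ⟨a, a', b, hb, rfl⟩
  simp only [SetLike.mem_coe, Submodule.mem_comap, map_sub, lTensor_tmul, mulRight_apply]
  rw [mul_assoc]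
  exact Submodule.subset_span ⟨a, a' * c, b, hb, rfl⟩

/-- The left `A`-action on `A ⊗_B A` through the left tensorand. -/
def lmulA (ca : ComodAlg wb A) (c : A) : ca.QA →ₗ[k] ca.QA :=
  Submodule.mapQ _ _ (rTensor A (mulLeft k c)) (ca.lmulA_aux c)

/-- The right `A`-action on `A ⊗_B A` through the right tensorand. -/
def rmulA (ca : ComodAlg wb A) (c : A) : ca.QA →ₗ[k] ca.QA :=
  Submodule.mapQ _ _ (lTensor A (mulRight k c)) (ca.rmulA_aux c)

end ComodAlg

section Convolution

variable {k : Type*} [Field k] {C : Type*} [AddCommGroup C] [Module k C]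
  {M : Type*} [Ring M] [Algebra k M] {M' : Type*} [Ring M'] [Algebra k M']

/-- The convolution product of linear maps along a comultiplication `Δ`. -/
def conv (Δ : C →ₗ[k] C ⊗[k] C) (f g : C →ₗ[k] M) : C →ₗ[k] M :=
  LinearMap.mul' k M ∘ₗ TensorProduct.map f g ∘ₗ Δ

theorem conv_apply (Δ : C →ₗ[k] C ⊗[k] C) (f g : C →ₗ[k] M) (x : C) :
    conv Δ f g x = LinearMap.mul' k M (TensorProduct.map f g (Δ x)) := rfl

theorem conv_assoc {Δ : C →ₗ[k] C ⊗[k] C}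
    (hΔ : ∀ x, TensorProduct.assoc k C C C (rTensor C Δ (Δ x)) = lTensor C Δ (Δ x))
    (f g h : C →ₗ[k] M) : conv Δ (conv Δ f g) h = conv Δ f (conv Δ g h) := by
  have left : ∀ z : C ⊗[k] C, LinearMap.mul' k M (TensorProduct.map (conv Δ f g) h z) =
      LinearMap.mul' k M (TensorProduct.map f (LinearMap.mul' k M ∘ₗ TensorProduct.map g h)
        (TensorProduct.assoc k C C C (rTensor C Δ z))) := by
    intro z
    induction z with
    | zero => simp
    | add z w hz hw => simp only [map_add, hz, hw]
    | tmul a b =>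
      simp only [map_tmul, mul'_apply, conv_apply, rTensor_tmul]
      induction Δ a with
      | zero => simp
      | add z w hz hw => simp only [map_add, add_mul, add_tmul, hz, hw]
      | tmul a b => simp [mul_assoc]
  have right : ∀ z : C ⊗[k] C, LinearMap.mul' k M (TensorProduct.map f (conv Δ g h) z) =
      LinearMap.mul' k M (TensorProduct.map f (LinearMap.mul' k M ∘ₗ TensorProduct.map g h)
        (lTensor C Δ z)) := by
    intro z
    induction z with
    | zero => simp
    | add z w hz hw => simp only [map_add, hz, hw]
    | tmul a b => simp [conv_apply]
  ext x
  rw [conv_apply, conv_apply, left, right, hΔ]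

/-- Composition with a multiplicative linear map distributes over convolution. -/
theorem conv_comp_left (Δ : C →ₗ[k] C ⊗[k] C) (ψ : M →ₗ[k] M')
    (hψ : ∀ x y, ψ (x * y) = ψ x * ψ y) (f g : C →ₗ[k] M) :
    conv Δ (ψ ∘ₗ f) (ψ ∘ₗ g) = ψ ∘ₗ conv Δ f g := by
  ext x
  simp only [conv_apply, comp_apply]
  induction Δ x with
  | zero => simp
  | add z w hz hw => simp only [map_add, hz, hw]
  | tmul a b => simp [hψ]

theorem conv_mulLeft_comp (Δ : C →ₗ[k] C ⊗[k] C) (l : M) (f g : C →ₗ[k] M) :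
    conv Δ (mulLeft k l ∘ₗ f) g = mulLeft k l ∘ₗ conv Δ f g := by
  ext x
  simp only [conv_apply, comp_apply]
  induction Δ x with
  | zero => simp
  | add z w hz hw => simp only [map_add, hz, hw]
  | tmul a b => simp [mul_assoc]

theorem conv_mulRight_comp (Δ : C →ₗ[k] C ⊗[k] C) (r : M) (f g : C →ₗ[k] M) :
    conv Δ f (mulRight k r ∘ₗ g) = mulRight k r ∘ₗ conv Δ f g := by
  ext x
  simp only [conv_apply, comp_apply]
  induction Δ x with
  | zero => simp
  | add z w hz hw => simp only [map_add, hz, hw]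
  | tmul a b => simp [mul_assoc]

theorem mulLeft_add_left (a b : M) : mulLeft k (a + b) = mulLeft k a + mulLeft k b := by
  ext
  simp [add_mul]

theorem mulRight_add_right (a b : M) : mulRight k (a + b) = mulRight k a + mulRight k b := by
  ext
  simp [mul_add]

/-- Generalized convolution inverses are determined by their two-sided products. -/
theorem conv_inverse_unique {Δ : C →ₗ[k] C ⊗[k] C}
    (hΔ : ∀ x, TensorProduct.assoc k C C C (rTensor C Δ (Δ x)) = lTensor C Δ (Δ x))
    {f g g' : C →ₗ[k] M} (hl : conv Δ g f = conv Δ g' f) (hr : conv Δ f g = conv Δ f g')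
    (hg : conv Δ (conv Δ g f) g = g) (hg' : conv Δ g' (conv Δ f g') = g') : g = g' := by
  rw [← hg, hl, conv_assoc hΔ, hr, hg']

end Convolution

namespace WeakBialgebra

variable {k : Type*} [Field k] {H : Type*} [Ring H] [Algebra k H] [FiniteDimensional k H]
variable (wb : WeakBialgebra k H)

theorem projL_apply (x : H) : wb.projL x = wb.εid (wb.comul 1 * x ⊗ₜ[k] (1 : H)) := rfl

theorem projR_apply (x : H) : wb.projR x = wb.idε ((1 : H) ⊗ₜ[k] x * wb.comul 1) := rfl

theorem projBarL_apply (x : H) : wb.projBarL x = wb.idε (wb.comul 1 * (1 : H) ⊗ₜ[k] x) := rfl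

theorem projBarR_apply (x : H) : wb.projBarR x = wb.εid (x ⊗ₜ[k] (1 : H) * wb.comul 1) := rfl

@[simp]
theorem εid_tmul (x y : H) : wb.εid (x ⊗ₜ[k] y) = wb.counit x • y := by simp [εid]

@[simp]
theorem idε_tmul (x y : H) : wb.idε (x ⊗ₜ[k] y) = wb.counit y • x := by simp [idε]

@[simp]
theorem εid_comul (x : H) : wb.εid (wb.comul x) = x := wb.rTensor_counit_comul x

@[simp]
theorem idε_comul (x : H) : wb.idε (wb.comul x) = x := wb.lTensor_counit_comul x

theorem comul_one_mul_comul (x : H) : wb.comul 1 * wb.comul x = wb.comul x := by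
  rw [← wb.comul_mul, one_mul]

theorem comul_mul_comul_one (x : H) : wb.comul x * wb.comul 1 = wb.comul x := by
  rw [← wb.comul_mul, mul_one]

theorem projL_one : wb.projL 1 = 1 := by
  rw [projL_apply, ← Algebra.TensorProduct.one_def, mul_one, εid_comul]

theorem projR_one : wb.projR 1 = 1 := by
  rw [projR_apply, ← Algebra.TensorProduct.one_def, one_mul, idε_comul]

theorem counit_mul_projL (x y : H) : wb.counit (x * wb.projL y) = wb.counit (x * y) := by
  have key : ∀ w : H ⊗[k] H, wb.counit (x * wb.εid (w * y ⊗ₜ[k] (1 : H))) =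
      LinearMap.mul' k k (TensorProduct.map (wb.counit ∘ₗ mulRight k y)
        (wb.counit ∘ₗ mulLeft k x) w) := by
    intro w
    induction w with
    | zero => simp
    | add z w hz hw => simp only [map_add, add_mul, mul_add, hz, hw]
    | tmul a b => simp
  rw [projL_apply, key, ← wb.weak_counit₂, mul_one]

theorem counit_projR_mul (x y : H) : wb.counit (wb.projR x * y) = wb.counit (x * y) := by
  have key : ∀ w : H ⊗[k] H, wb.counit (wb.idε ((1 : H) ⊗ₜ[k] x * w) * y) =
      LinearMap.mul' k k (TensorProduct.map (wb.counit ∘ₗ mulRight k y)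
        (wb.counit ∘ₗ mulLeft k x) w) := by
    intro w
    induction w with
    | zero => simp
    | add z w hz hw => simp only [map_add, add_mul, mul_add, hz, hw]
    | tmul a b => simp [mul_comm]
  rw [projR_apply, key, ← wb.weak_counit₂, mul_one]

theorem counit_mul_projBarL (x y : H) : wb.counit (x * wb.projBarL y) = wb.counit (x * y) := by
  have key : ∀ w : H ⊗[k] H, wb.counit (x * wb.idε (w * (1 : H) ⊗ₜ[k] y)) =
      LinearMap.mul' k k (TensorProduct.map (wb.counit ∘ₗ mulLeft k x)
        (wb.counit ∘ₗ mulRight k y) w) := by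
    intro w
    induction w with
    | zero => simp
    | add z w hz hw => simp only [map_add, add_mul, mul_add, hz, hw]
    | tmul a b => simp [mul_comm]
  rw [projBarL_apply, key, ← wb.weak_counit₁, mul_one]

theorem counit_projBarR_mul (x y : H) : wb.counit (wb.projBarR x * y) = wb.counit (x * y) := by
  have key : ∀ w : H ⊗[k] H, wb.counit (wb.εid (x ⊗ₜ[k] (1 : H) * w) * y) =
      LinearMap.mul' k k (TensorProduct.map (wb.counit ∘ₗ mulLeft k x)
        (wb.counit ∘ₗ mulRight k y) w) := by
    intro w
    induction w with
    | zero => simp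
    | add z w hz hw => simp only [map_add, add_mul, mul_add, hz, hw]
    | tmul a b => simp
  rw [projBarR_apply, key, ← wb.weak_counit₁, mul_one]

/-- `x₍₁₎ ⊗ Π^L(x₍₂₎) = 1₍₁₎x ⊗ 1₍₂₎`. -/
theorem lTensor_projL_comul (x : H) :
    lTensor H wb.projL (wb.comul x) = wb.comul 1 * x ⊗ₜ[k] (1 : H) := by
  have expand : ∀ z : H ⊗[k] H, lTensor H wb.projL z = lTensor H wb.εid
      (((1 : H) ⊗ₜ[k] wb.comul 1) * TensorProduct.assoc k H H H (z ⊗ₜ[k] (1 : H))) := by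
    intro z
    induction z with
    | zero => simp
    | add z w hz hw => simp only [map_add, add_tmul, mul_add, hz, hw]
    | tmul a b => simp [projL_apply]
  have contract : ∀ (u : H ⊗[k] H) (b : H),
      lTensor H wb.εid (TensorProduct.assoc k H H H (u ⊗ₜ[k] b)) = wb.idε u ⊗ₜ[k] b := by
    intro u b
    induction u with
    | zero => simp
    | add z w hz hw => simp only [map_add, add_tmul, hz, hw]
    | tmul a c => simp [smul_tmul]
  have mul_assoc_tmul : ∀ (z u : H ⊗[k] H) (b : H),
      TensorProduct.assoc k H H H (z ⊗ₜ[k] b) * TensorProduct.assoc k H H H (u ⊗ₜ[k] (1 : H)) =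
        TensorProduct.assoc k H H H ((z * u) ⊗ₜ[k] b) := by
    intro z u b
    induction z with
    | zero => simp
    | add z z' hz hz' => simp only [add_mul, add_tmul, map_add, hz, hz']
    | tmul a b =>
      induction u with
      | zero => simp
      | add z z' hz hz' => simp only [mul_add, add_tmul, map_add, hz, hz']
      | tmul c d => simp
  have collapse : ∀ w : H ⊗[k] H, lTensor H wb.εid
      (TensorProduct.assoc k H H H (rTensor H wb.comul w) *
        TensorProduct.assoc k H H H (wb.comul x ⊗ₜ[k] (1 : H))) = w * x ⊗ₜ[k] (1 : H) := by
    intro w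
    induction w with
    | zero => simp
    | add z w hz hw => simp only [map_add, add_mul, hz, hw]
    | tmul a b =>
      rw [rTensor_tmul, mul_assoc_tmul, ← wb.comul_mul, contract, idε_comul]
      simp
  rw [expand, ← comul_one_mul_comul wb x, ← mul_assoc_tmul, ← mul_assoc, ← wb.weak_one₂,
    ← wb.coassoc, collapse]

/-- `Π^R(x₍₁₎) ⊗ x₍₂₎ = 1₍₁₎ ⊗ x1₍₂₎`. -/
theorem rTensor_projR_comul (x : H) :
    rTensor H wb.projR (wb.comul x) = (1 : H) ⊗ₜ[k] x * wb.comul 1 := by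
  have expand_aux : ∀ (a b : H) (w : H ⊗[k] H), wb.idε ((1 : H) ⊗ₜ[k] a * w) ⊗ₜ[k] b =
      rTensor H wb.idε ((TensorProduct.assoc k H H H).symm
        ((1 : H) ⊗ₜ[k] (a ⊗ₜ[k] b) * TensorProduct.assoc k H H H (w ⊗ₜ[k] (1 : H)))) := by
    intro a b w
    induction w with
    | zero => simp
    | add z w hz hw => simp only [map_add, add_tmul, mul_add, hz, hw]
    | tmul c d => simp
  have expand : ∀ z : H ⊗[k] H, rTensor H wb.projR z = rTensor H wb.idε
      ((TensorProduct.assoc k H H H).symm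
        ((1 : H) ⊗ₜ[k] z * TensorProduct.assoc k H H H (wb.comul 1 ⊗ₜ[k] (1 : H)))) := by
    intro z
    induction z with
    | zero => simp
    | add z w hz hw => simp only [map_add, tmul_add, add_mul, hz, hw]
    | tmul a b => rw [rTensor_tmul, projR_apply, expand_aux]
  have contract : ∀ (u : H ⊗[k] H) (a : H),
      rTensor H wb.idε ((TensorProduct.assoc k H H H).symm (a ⊗ₜ[k] u)) = a ⊗ₜ[k] wb.εid u := by
    intro u b
    induction u with
    | zero => simp
    | add z w hz hw => simp only [map_add, tmul_add, hz, hw]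
    | tmul a c => simp [smul_tmul]
  have collapse : ∀ w : H ⊗[k] H, rTensor H wb.idε ((TensorProduct.assoc k H H H).symm
      ((1 : H) ⊗ₜ[k] wb.comul x * lTensor H wb.comul w)) = (1 : H) ⊗ₜ[k] x * w := by
    intro w
    induction w with
    | zero => simp
    | add z w hz hw => simp only [map_add, mul_add, hz, hw]
    | tmul a b =>
      rw [lTensor_tmul, Algebra.TensorProduct.tmul_mul_tmul, ← wb.comul_mul, contract, εid_comul]
      simp
  have split : (1 : H) ⊗ₜ[k] wb.comul x = (1 : H) ⊗ₜ[k] wb.comul x * (1 : H) ⊗ₜ[k] wb.comul 1 := by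
    rw [Algebra.TensorProduct.tmul_mul_tmul, comul_mul_comul_one, one_mul]
  rw [expand, split, mul_assoc, ← wb.weak_one₂, collapse]

theorem lTensor_projL_comul_one : lTensor H wb.projL (wb.comul 1) = wb.comul 1 := by
  rw [lTensor_projL_comul, ← Algebra.TensorProduct.one_def, mul_one]

theorem rTensor_projR_comul_one : rTensor H wb.projR (wb.comul 1) = wb.comul 1 := by
  rw [rTensor_projR_comul, ← Algebra.TensorProduct.one_def, one_mul]

theorem projL_projBarL (x : H) : wb.projL (wb.projBarL x) = wb.projL x := by
  rw [projL_apply, projL_apply]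
  induction wb.comul 1 with
  | zero => simp
  | add z w hz hw => simp only [map_add, add_mul, hz, hw]
  | tmul a b => simp [counit_mul_projBarL]

theorem projR_projBarR (x : H) : wb.projR (wb.projBarR x) = wb.projR x := by
  rw [projR_apply, projR_apply]
  induction wb.comul 1 with
  | zero => simp
  | add z w hz hw => simp only [map_add, mul_add, hz, hw]
  | tmul a b => simp [counit_projBarR_mul]

theorem projR_projBarL (x : H) : wb.projR (wb.projBarL x) = wb.projBarL x := by
  have key : ∀ w : H ⊗[k] H, wb.projR (wb.idε (w * (1 : H) ⊗ₜ[k] x)) =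
      wb.idε (rTensor H wb.projR w * (1 : H) ⊗ₜ[k] x) := by
    intro w
    induction w with
    | zero => simp
    | add z w hz hw => simp only [map_add, add_mul, hz, hw]
    | tmul a b => simp
  rw [projBarL_apply, key, rTensor_projR_comul_one]

theorem projL_projBarR (x : H) : wb.projL (wb.projBarR x) = wb.projBarR x := by
  have key : ∀ w : H ⊗[k] H, wb.projL (wb.εid (x ⊗ₜ[k] (1 : H) * w)) =
      wb.εid (x ⊗ₜ[k] (1 : H) * lTensor H wb.projL w) := by
    intro w
    induction w with
    | zero => simp
    | add z w hz hw => simp only [map_add, mul_add, hz, hw]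
    | tmul a b => simp
  rw [projBarR_apply, key, lTensor_projL_comul_one]

theorem projL_mul_projR_comm (x y : H) :
    wb.projL x * wb.projR y = wb.projR y * wb.projL x := by
  let G : H ⊗[k] (H ⊗[k] H) →ₗ[k] H := (TensorProduct.lid k H).toLinearMap ∘ₗ
    TensorProduct.map (wb.counit ∘ₗ mulRight k x)
      ((TensorProduct.rid k H).toLinearMap ∘ₗ lTensor H (wb.counit ∘ₗ mulLeft k y))
  have left : ∀ w w' : H ⊗[k] H,
      G (TensorProduct.assoc k H H H (w ⊗ₜ[k] (1 : H)) * (1 : H) ⊗ₜ[k] w') =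
        wb.εid (w * x ⊗ₜ[k] (1 : H)) * wb.idε ((1 : H) ⊗ₜ[k] y * w') := by
    intro w w'
    induction w with
    | zero => simp
    | add z w hz hw => simp only [map_add, add_mul, add_tmul, hz, hw]
    | tmul a b =>
      induction w' with
      | zero => simp
      | add z w hz hw => simp only [map_add, mul_add, tmul_add, hz, hw]
      | tmul c d => simp [G]
  have right : ∀ w w' : H ⊗[k] H,
      G ((1 : H) ⊗ₜ[k] w' * TensorProduct.assoc k H H H (w ⊗ₜ[k] (1 : H))) =
        wb.idε ((1 : H) ⊗ₜ[k] y * w') * wb.εid (w * x ⊗ₜ[k] (1 : H)) := by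
    intro w w'
    induction w with
    | zero => simp
    | add z w hz hw => simp only [map_add, mul_add, add_mul, add_tmul, hz, hw]
    | tmul a b =>
      induction w' with
      | zero => simp
      | add z w hz hw => simp only [map_add, add_mul, mul_add, tmul_add, hz, hw]
      | tmul c d => simp [G, smul_smul, mul_comm]
  rw [projL_apply, projR_apply, ← left, ← right, ← wb.weak_one₁, ← wb.weak_one₂]

/-- `Δ(r) = 1₍₁₎ ⊗ r1₍₂₎` for `r` in the image of `Π^R`. -/
theorem comul_projR (x : H) : wb.comul (wb.projR x) = (1 : H) ⊗ₜ[k] wb.projR x * wb.comul 1 := by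
  have expand_aux : ∀ (u : H ⊗[k] H) (b : H), wb.counit (x * b) • u = lTensor H wb.idε
      ((1 : H) ⊗ₜ[k] ((1 : H) ⊗ₜ[k] x) * TensorProduct.assoc k H H H (u ⊗ₜ[k] b)) := by
    intro u b
    induction u with
    | zero => simp
    | add z w hz hw => simp only [map_add, mul_add, add_tmul, smul_add, hz, hw]
    | tmul c d => simp
  have expand : ∀ w : H ⊗[k] H, wb.comul (wb.idε ((1 : H) ⊗ₜ[k] x * w)) = lTensor H wb.idε
      ((1 : H) ⊗ₜ[k] ((1 : H) ⊗ₜ[k] x) *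
        TensorProduct.assoc k H H H (rTensor H wb.comul w)) := by
    intro w
    induction w with
    | zero => simp
    | add z w hz hw => simp only [map_add, mul_add, hz, hw]
    | tmul a b => simp [← expand_aux]
  have collapse : ∀ w w' : H ⊗[k] H, lTensor H wb.idε ((1 : H) ⊗ₜ[k] ((1 : H) ⊗ₜ[k] x) *
      ((1 : H) ⊗ₜ[k] w' * TensorProduct.assoc k H H H (w ⊗ₜ[k] (1 : H)))) =
        (1 : H) ⊗ₜ[k] wb.idε ((1 : H) ⊗ₜ[k] x * w') * w := by
    intro w w'
    induction w with
    | zero => simp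
    | add z w hz hw => simp only [map_add, mul_add, add_tmul, hz, hw]
    | tmul a b =>
      induction w' with
      | zero => simp
      | add z w hz hw => simp only [map_add, add_mul, mul_add, tmul_add, hz, hw]
      | tmul c d => simp
  rw [projR_apply, expand, wb.coassoc, wb.weak_one₂, collapse]

/-- `Δ(l) = 1₍₁₎l ⊗ 1₍₂₎` for `l` in the image of `Π^L`. -/
theorem comul_projL (x : H) : wb.comul (wb.projL x) = wb.comul 1 * wb.projL x ⊗ₜ[k] (1 : H) := by
  let K : H ⊗[k] (H ⊗[k] H) →ₗ[k] H ⊗[k] H :=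
    (TensorProduct.lid k _).toLinearMap ∘ₗ rTensor _ (wb.counit ∘ₗ mulRight k x)
  have expand : ∀ w : H ⊗[k] H, wb.comul (wb.εid (w * x ⊗ₜ[k] (1 : H))) =
      K (lTensor H wb.comul w) := by
    intro w
    induction w with
    | zero => simp
    | add z w hz hw => simp only [map_add, add_mul, hz, hw]
    | tmul a b => simp [K]
  have collapse : ∀ w w' : H ⊗[k] H,
      K ((1 : H) ⊗ₜ[k] w' * TensorProduct.assoc k H H H (w ⊗ₜ[k] (1 : H))) =
        w' * wb.εid (w * x ⊗ₜ[k] (1 : H)) ⊗ₜ[k] (1 : H) := by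
    intro w w'
    induction w with
    | zero => simp
    | add z w hz hw => simp only [map_add, mul_add, add_mul, add_tmul, hz, hw]
    | tmul a b =>
      induction w' with
      | zero => simp
      | add z w hz hw => simp only [map_add, add_mul, tmul_add, hz, hw]
      | tmul c d => simp [K, smul_tmul']
  rw [projL_apply, expand, wb.weak_one₂, collapse]

/-- The linear map `y ↦ ε(xy)1`. -/
def counitMulLeft (x : H) : H →ₗ[k] H := Algebra.linearMap k H ∘ₗ wb.counit ∘ₗ mulLeft k x

/-- The linear map `y ↦ ε(yx)1`. -/
def counitMulRight (x : H) : H →ₗ[k] H := Algebra.linearMap k H ∘ₗ wb.counit ∘ₗ mulRight k x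

/-- `y₍₁₎ε(xy₍₂₎) = Π^R(x)y`. -/
theorem conv_id_counitMulLeft (x : H) :
    conv wb.comul LinearMap.id (wb.counitMulLeft x) = mulLeft k (wb.projR x) := by
  have left : ∀ z : H ⊗[k] H, LinearMap.mul' k H
      (TensorProduct.map LinearMap.id (wb.counitMulLeft x) z) =
        wb.idε ((1 : H) ⊗ₜ[k] x * lTensor H wb.projL z) := by
    intro z
    induction z with
    | zero => simp
    | add z w hz hw => simp only [map_add, mul_add, hz, hw]
    | tmul a b => simp [counitMulLeft, counit_mul_projL, Algebra.smul_def, Algebra.commutes]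
  ext y
  rw [conv_apply, left, lTensor_projL_comul, mulLeft_apply, projR_apply]
  induction wb.comul 1 with
  | zero => simp
  | add z w hz hw => simp only [map_add, mul_add, add_mul, hz, hw]
  | tmul a b => simp

/-- `ε(x₍₁₎y)x₍₂₎ = xΠ^L(y)`. -/
theorem conv_counitMulRight_id (y : H) :
    conv wb.comul (wb.counitMulRight y) LinearMap.id = mulRight k (wb.projL y) := by
  have left : ∀ z : H ⊗[k] H, LinearMap.mul' k H
      (TensorProduct.map (wb.counitMulRight y) LinearMap.id z) =
        wb.εid (rTensor H wb.projR z * y ⊗ₜ[k] (1 : H)) := by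
    intro z
    induction z with
    | zero => simp
    | add z w hz hw => simp only [map_add, add_mul, hz, hw]
    | tmul a b => simp [counitMulRight, counit_projR_mul, Algebra.smul_def]
  ext x
  rw [conv_apply, left, rTensor_projR_comul, mulRight_apply, projL_apply]
  induction wb.comul 1 with
  | zero => simp
  | add z w hz hw => simp only [map_add, mul_add, add_mul, hz, hw]
  | tmul a b => simp

theorem conv_projR_counitMulLeft (x : H) :
    conv wb.comul wb.projR (wb.counitMulLeft x) = wb.projR ∘ₗ mulLeft k x := by
  ext y
  have key : ∀ w : H ⊗[k] H, wb.idε ((1 : H) ⊗ₜ[k] (x * y) * w) =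
      LinearMap.mul' k H (TensorProduct.map
        (wb.idε ∘ₗ mulRight k w ∘ₗ TensorProduct.mk k H H 1) (wb.counitMulLeft x)
        (wb.comul y)) := by
    intro w
    induction w with
    | zero => simp
    | add z w hz hw =>
      simp only [map_add, mul_add, hz, hw, mulRight_add_right, add_comp, comp_add,
        TensorProduct.map_add_left, LinearMap.add_apply]
    | tmul a b =>
      simp only [Algebra.TensorProduct.tmul_mul_tmul, one_mul, idε_tmul, wb.weak_counit₂ x y b]
      induction wb.comul y with
      | zero => simp
      | add z w hz hw => simp only [map_add, add_smul, hz, hw]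
      | tmul c d =>
        simp [counitMulLeft, Algebra.algebraMap_eq_smul_one, smul_smul, mul_comm]
  rw [comp_apply, mulLeft_apply, projR_apply, key]
  rfl

theorem conv_counitMulRight_projL (y : H) :
    conv wb.comul (wb.counitMulRight y) wb.projL = wb.projL ∘ₗ mulRight k y := by
  ext x
  have key : ∀ w : H ⊗[k] H, wb.εid (w * (x * y) ⊗ₜ[k] (1 : H)) =
      LinearMap.mul' k H (TensorProduct.map (wb.counitMulRight y)
        (wb.εid ∘ₗ mulLeft k w ∘ₗ (TensorProduct.mk k H H).flip 1) (wb.comul x)) := by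
    intro w
    induction w with
    | zero => simp
    | add z w hz hw =>
      simp only [map_add, add_mul, hz, hw, mulLeft_add_left, add_comp, comp_add,
        TensorProduct.map_add_right, LinearMap.add_apply]
    | tmul a b =>
      simp only [Algebra.TensorProduct.tmul_mul_tmul, mul_one, εid_tmul, ← mul_assoc,
        wb.weak_counit₂ a x y]
      induction wb.comul x with
      | zero => simp
      | add z w hz hw => simp only [map_add, add_smul, hz, hw]
      | tmul c d =>
        simp [counitMulRight, Algebra.smul_def, mul_assoc]
  rw [comp_apply, mulRight_apply, projL_apply, key]
  rfl

theorem conv_projL_id : conv wb.comul wb.projL LinearMap.id = LinearMap.id := by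
  have key : ∀ w z : H ⊗[k] H, LinearMap.mul' k H (TensorProduct.map
      (wb.εid ∘ₗ mulLeft k w ∘ₗ (TensorProduct.mk k H H).flip 1) LinearMap.id z) =
        wb.εid (w * z) := by
    intro w z
    induction z with
    | zero => simp
    | add z z' hz hz' => simp only [map_add, mul_add, hz, hz']
    | tmul a b =>
      induction w with
      | zero => simp
      | add w w' hw hw' =>
        simp only [map_add, add_mul, mulLeft_add_left, add_comp, comp_add,
          TensorProduct.map_add_left, LinearMap.add_apply, hw, hw']
      | tmul c d => simp
  ext x
  exact (key _ _).trans (by rw [comul_one_mul_comul, εid_comul, id_apply])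

namespace IsAntipode

variable {wb} {S : H →ₗ[k] H} (hS : wb.IsAntipode S)
include hS

theorem conv_antipode_id : conv wb.comul S LinearMap.id = wb.projR :=
  LinearMap.ext hS.antipode_left

theorem conv_id_antipode : conv wb.comul LinearMap.id S = wb.projL :=
  LinearMap.ext hS.antipode_right

theorem conv_projR_antipode : conv wb.comul wb.projR S = S := by
  have key : ∀ z : H ⊗[k] H, TensorProduct.map wb.projR S z =
      TensorProduct.map (LinearMap.mul' k H ∘ₗ rTensor H S) S (rTensor H wb.comul z) := by
    intro z
    induction z with
    | zero => simp
    | add z w hz hw => simp only [map_add, hz, hw]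
    | tmul a b => simp [hS.antipode_left]
  ext x
  rw [conv_apply, key, hS.antipode_mid]

theorem conv_antipode_projL : conv wb.comul S wb.projL = S := by
  rw [← hS.conv_id_antipode, ← conv_assoc wb.coassoc, hS.conv_antipode_id, hS.conv_projR_antipode]

theorem conv_id_projR : conv wb.comul LinearMap.id wb.projR = LinearMap.id := by
  rw [← hS.conv_antipode_id, ← conv_assoc wb.coassoc, hS.conv_id_antipode, wb.conv_projL_id]

theorem conv_antipode_mulLeft_projR (x : H) :
    conv wb.comul S (mulLeft k (wb.projR x)) = wb.projR ∘ₗ mulLeft k x := by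
  rw [← conv_id_counitMulLeft, ← conv_assoc wb.coassoc, hS.conv_antipode_id,
    conv_projR_counitMulLeft]

theorem conv_mulRight_projL_antipode (y : H) :
    conv wb.comul (mulRight k (wb.projL y)) S = wb.projL ∘ₗ mulRight k y := by
  rw [← conv_counitMulRight_id, conv_assoc wb.coassoc, hS.conv_id_antipode,
    conv_counitMulRight_projL]

theorem conv_antipode_conv_mulRight_projL_antipode (z : H) :
    conv wb.comul S (conv wb.comul (mulRight k (wb.projL z)) S) =
      mulLeft k (wb.projL z) ∘ₗ S := by
  have hcomm : mulRight k (wb.projL z) ∘ₗ wb.projR = mulLeft k (wb.projL z) ∘ₗ wb.projR := by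
    ext x
    simp [projL_mul_projR_comm]
  have h := conv_mulRight_comp wb.comul (wb.projL z) S LinearMap.id
  rw [hS.conv_antipode_id, hcomm, comp_id] at h
  rw [← conv_assoc wb.coassoc, h, conv_mulLeft_comp, hS.conv_projR_antipode]

/-- The antipode of a weak Hopf algebra is antimultiplicative. -/
theorem map_mul (x y : H) : S (x * y) = S y * S x := by
  let δ : H ⊗[k] H →ₗ[k] (H ⊗[k] H) ⊗[k] (H ⊗[k] H) :=
    (TensorProduct.tensorTensorTensorComm k H H H H).toLinearMap ∘ₗ
      TensorProduct.map wb.comul wb.comul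
  have hδ : ∀ z, TensorProduct.assoc k _ _ _ (rTensor _ δ (δ z)) = lTensor _ δ (δ z) := by
    let _ : Coalgebra k H :=
      { comul := wb.comul
        counit := wb.counit
        coassoc := LinearMap.ext wb.coassoc
        rTensor_counit_comp_comul := LinearMap.ext fun x =>
          (TensorProduct.lid k H).injective (by simpa using wb.rTensor_counit_comul x)
        lTensor_counit_comp_comul := LinearMap.ext fun x =>
          (TensorProduct.rid k H).injective (by simpa using wb.lTensor_counit_comul x) }
    exact fun z => Coalgebra.coassoc_apply (R := k) z
  let m := LinearMap.mul' k H
  have hm : ∀ z, TensorProduct.map m m (δ z) = wb.comul (m z) := by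
    have aux : ∀ u v : H ⊗[k] H, TensorProduct.map m m
        (TensorProduct.tensorTensorTensorComm k H H H H (u ⊗ₜ[k] v)) = u * v := by
      intro u v
      induction u with
      | zero => simp
      | add u u' hu hu' => simp only [map_add, add_tmul, add_mul, hu, hu']
      | tmul a b =>
        induction v with
        | zero => simp
        | add u u' hu hu' => simp only [map_add, tmul_add, mul_add, hu, hu']
        | tmul c d => simp [m]
    intro z
    induction z with
    | zero => simp
    | add z w hz hw => simp only [map_add, hz, hw]
    | tmul a b => simp [δ, aux, m, wb.comul_mul]
  have conv_comp_m : ∀ f g : H →ₗ[k] H, conv δ (f ∘ₗ m) (g ∘ₗ m) = conv wb.comul f g ∘ₗ m := by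
    intro f g
    refine LinearMap.ext fun z => ?_
    rw [comp_apply, conv_apply, conv_apply, ← hm, TensorProduct.map_comp, comp_apply]
  have conv_tmul : ∀ (f g : H ⊗[k] H →ₗ[k] H) (x y : H), conv δ f g (x ⊗ₜ[k] y) =
      LinearMap.mul' k H (TensorProduct.map f g
        (TensorProduct.tensorTensorTensorComm k H H H H (wb.comul x ⊗ₜ[k] wb.comul y))) :=
    fun _ _ _ _ => rfl
  let G : H ⊗[k] H →ₗ[k] H := m ∘ₗ TensorProduct.map S S ∘ₗ (TensorProduct.comm k H H).toLinearMap
  have hGm : conv δ G m = wb.projR ∘ₗ m := by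
    refine TensorProduct.ext' fun x y => ?_
    have key : ∀ u v : H ⊗[k] H, m (TensorProduct.map G m
        (TensorProduct.tensorTensorTensorComm k H H H H (u ⊗ₜ[k] v))) =
          m (TensorProduct.map S (mulLeft k (m (TensorProduct.map S LinearMap.id u))) v) := by
      intro u v
      induction u with
      | zero => simp
      | add u u' hu hu' =>
        simp only [map_add, add_tmul, mulLeft_add_left, TensorProduct.map_add_right,
          LinearMap.add_apply, hu, hu']
      | tmul a b =>
        induction v with
        | zero => simp
        | add u u' hu hu' => simp only [map_add, tmul_add, hu, hu']
        | tmul c d => simp [m, G, mul_assoc]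
    rw [conv_tmul]
    refine (key _ _).trans ?_
    have h := LinearMap.congr_fun hS.conv_antipode_id x
    rw [conv_apply] at h
    rw [h]
    exact LinearMap.congr_fun (hS.conv_antipode_mulLeft_projR x) y
  have hmG_tmul : ∀ x y : H, conv δ m G (x ⊗ₜ[k] y) =
      conv wb.comul (mulRight k (wb.projL y)) S x := by
    intro x y
    have key : ∀ u v : H ⊗[k] H, m (TensorProduct.map m G
        (TensorProduct.tensorTensorTensorComm k H H H H (u ⊗ₜ[k] v))) =
          m (TensorProduct.map (mulRight k (m (TensorProduct.map LinearMap.id S v))) S u) := by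
      intro u v
      induction v with
      | zero => simp
      | add u u' hu hu' =>
        simp only [map_add, tmul_add, mulRight_add_right, TensorProduct.map_add_left,
          LinearMap.add_apply, hu, hu']
      | tmul a b =>
        induction u with
        | zero => simp
        | add u u' hu hu' => simp only [map_add, add_tmul, hu, hu']
        | tmul c d => simp [m, G, mul_assoc]
    rw [conv_tmul]
    refine (key _ _).trans ?_
    have h := LinearMap.congr_fun hS.conv_id_antipode y
    rw [conv_apply] at h
    rw [h]
    rfl
  have hmG : conv δ m G = wb.projL ∘ₗ m := by
    refine TensorProduct.ext' fun x y => ?_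
    rw [hmG_tmul, hS.conv_mulRight_projL_antipode]
    simp [m]
  have hGmG : conv δ G (conv δ m G) = G := by
    refine TensorProduct.ext' fun x y => ?_
    have inner : ∀ (c d : H) (u : H ⊗[k] H), m (TensorProduct.map G (conv δ m G)
        (TensorProduct.tensorTensorTensorComm k H H H H (u ⊗ₜ[k] (c ⊗ₜ[k] d)))) =
          S c * m (TensorProduct.map S (conv wb.comul (mulRight k (wb.projL d)) S) u) := by
      intro c d u
      induction u with
      | zero => simp
      | add u u' hu hu' => simp only [map_add, add_tmul, mul_add, hu, hu']
      | tmul a b => simp [m, G, mul_assoc, hmG_tmul]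
    have key : ∀ v : H ⊗[k] H, m (TensorProduct.map G (conv δ m G)
        (TensorProduct.tensorTensorTensorComm k H H H H (wb.comul x ⊗ₜ[k] v))) =
          m (TensorProduct.map S wb.projL v) * S x := by
      intro v
      induction v with
      | zero => simp
      | add u u' hu hu' => simp only [map_add, tmul_add, add_mul, hu, hu']
      | tmul c d =>
        rw [inner]
        have h := LinearMap.congr_fun (hS.conv_antipode_conv_mulRight_projL_antipode d) x
        rw [conv_apply] at h
        rw [h]
        simp [m, mul_assoc]
    rw [conv_tmul]
    refine (key _).trans ?_
    have h := LinearMap.congr_fun hS.conv_antipode_projL y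
    rw [conv_apply] at h
    rw [h]
    simp [m, G]
  have hS' : ∀ z, S (m z) = G z := by
    refine LinearMap.congr_fun (f := S ∘ₗ m) (conv_inverse_unique hδ (f := m) ?_ ?_ ?_ hGmG)
    · rw [hGm, ← hS.conv_antipode_id, ← conv_comp_m, id_comp]
    · rw [hmG, ← hS.conv_id_antipode, ← conv_comp_m, id_comp]
    · have h := conv_comp_m S LinearMap.id
      rw [id_comp] at h
      rw [h, conv_comp_m, hS.conv_antipode_id, hS.conv_projR_antipode]
  simpa [m, G] using hS' (x ⊗ₜ[k] y)

end IsAntipode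

end WeakBialgebra

namespace WeakBialgebra.IsAntipode

variable {k : Type*} [Field k] {H : Type*} [Ring H] [Algebra k H] [FiniteDimensional k H]
  {wb : WeakBialgebra k H} {S : H →ₗ[k] H} (hS : wb.IsAntipode S)
include hS

theorem antipode_projR (x : H) : S (wb.projR x) = wb.projL (wb.projR x) := by
  have key : ∀ (r : H) (w : H ⊗[k] H), LinearMap.mul' k H (lTensor H S ((1 : H) ⊗ₜ[k] r * w)) =
      LinearMap.mul' k H (lTensor H S w) * S r := by
    intro r w
    induction w with
    | zero => simp
    | add z w hz hw => simp only [map_add, mul_add, add_mul, hz, hw]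
    | tmul a b => simp [hS.map_mul, mul_assoc]
  rw [← hS.antipode_right, comul_projR, key, hS.antipode_right, projL_one, one_mul]

theorem antipode_projL (x : H) : S (wb.projL x) = wb.projR (wb.projL x) := by
  have key : ∀ (l : H) (w : H ⊗[k] H), LinearMap.mul' k H (rTensor H S (w * l ⊗ₜ[k] (1 : H))) =
      S l * LinearMap.mul' k H (rTensor H S w) := by
    intro l w
    induction w with
    | zero => simp
    | add z w hz hw => simp only [map_add, mul_add, add_mul, hz, hw]
    | tmul a b => simp [hS.map_mul, mul_assoc]
  rw [← hS.antipode_left, comul_projL, key, hS.antipode_left, projR_one, mul_one]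

theorem antipode_projBarL (x : H) : S (wb.projBarL x) = wb.projL x := by
  rw [← wb.projR_projBarL, hS.antipode_projR, projR_projBarL, projL_projBarL]

theorem antipode_projBarR (x : H) : S (wb.projBarR x) = wb.projR x := by
  rw [← wb.projL_projBarR, hS.antipode_projL, projL_projBarR, projR_projBarR]

theorem projL_projR_mem_range_pow (n : ℕ) (x : H) :
    wb.projL x ∈ LinearMap.range (S ^ n) ∧ wb.projR x ∈ LinearMap.range (S ^ n) := by
  induction n generalizing x with
  | zero => simp
  | succ n ih =>
    obtain ⟨y, hy⟩ := (ih (wb.projBarL x)).2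
    obtain ⟨z, hz⟩ := (ih (wb.projBarR x)).1
    rw [projR_projBarL] at hy
    rw [projL_projBarR] at hz
    exact ⟨⟨y, by rw [pow_succ', Module.End.mul_apply, hy, hS.antipode_projBarL]⟩,
      ⟨z, by rw [pow_succ', Module.End.mul_apply, hz, hS.antipode_projBarR]⟩⟩

theorem pow_map_mul (n : ℕ) :
    (∀ x y, (S ^ n) (x * y) = (S ^ n) x * (S ^ n) y) ∨
      ∀ x y, (S ^ n) (x * y) = (S ^ n) y * (S ^ n) x := by
  induction n with
  | zero => simp
  | succ n ih =>
    simp only [pow_succ', Module.End.mul_apply]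
    rcases ih with h | h
    · exact Or.inr fun x y => by rw [h, hS.map_mul]
    · exact Or.inl fun x y => by rw [h, hS.map_mul]

/-- Let `p` be a multiplicative map commuting with `S` and fixing the base algebras. If a
multiplicative map `ψ` satisfies `ψ S p = ψ S`, then `ψ p = ψ`. -/
theorem comp_eq_of_comp_antipode_comp_eq {M : Type*} [Ring M] [Algebra k M] {p : H →ₗ[k] H}
    (hmul : ∀ x y, p (x * y) = p x * p y) (hcomm : p ∘ₗ S = S ∘ₗ p)
    (hL : p ∘ₗ wb.projL = wb.projL) (hR : p ∘ₗ wb.projR = wb.projR) {ψ : H →ₗ[k] M}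
    (hψ : ∀ x y, ψ (x * y) = ψ x * ψ y) (h : ψ ∘ₗ S ∘ₗ p = ψ ∘ₗ S) : ψ ∘ₗ p = ψ := by
  have hψp : ∀ x y, (ψ ∘ₗ p) (x * y) = (ψ ∘ₗ p) x * (ψ ∘ₗ p) y := by simp [hmul, hψ]
  have hright : conv wb.comul (ψ ∘ₗ S) (ψ ∘ₗ p) = ψ ∘ₗ wb.projR := by
    rw [← h, ← hcomm, ← comp_assoc, ← hR, ← comp_assoc, ← hS.conv_antipode_id,
      ← conv_comp_left _ _ hψp, comp_id]
  calc ψ ∘ₗ p = conv wb.comul ((ψ ∘ₗ p) ∘ₗ wb.projL) (ψ ∘ₗ p) := by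
        conv_lhs => rw [← comp_id (ψ ∘ₗ p), ← wb.conv_projL_id, ← conv_comp_left _ _ hψp, comp_id]
    _ = conv wb.comul (conv wb.comul ψ (ψ ∘ₗ S)) (ψ ∘ₗ p) := by
        rw [comp_assoc, hL, ← hS.conv_id_antipode, ← conv_comp_left _ _ hψ, comp_id]
    _ = ψ := by
        rw [conv_assoc wb.coassoc, hright]
        conv_lhs => rw [← comp_id ψ]
        rw [comp_assoc, id_comp, conv_comp_left _ _ hψ, hS.conv_id_projR, comp_id]

theorem eq_id_of_pow_comp_eq {p : H →ₗ[k] H}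
    (hmul : ∀ x y, p (x * y) = p x * p y) (hcomm : p ∘ₗ S = S ∘ₗ p)
    (hL : p ∘ₗ wb.projL = wb.projL) (hR : p ∘ₗ wb.projR = wb.projR) (n : ℕ)
    (h : (S ^ n) ∘ₗ p = S ^ n) : p = LinearMap.id := by
  induction n with
  | zero => exact h
  | succ n ih =>
    apply ih
    rw [pow_succ, Module.End.mul_eq_comp, comp_assoc] at h
    rcases hS.pow_map_mul n with hn | hn
    · exact hS.comp_eq_of_comp_antipode_comp_eq hmul hcomm hL hR hn h
    · let e : H →ₗ[k] Hᵐᵒᵖ := (MulOpposite.opLinearEquiv k).toLinearMap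
      have hop := hS.comp_eq_of_comp_antipode_comp_eq (ψ := e ∘ₗ (S ^ n)) hmul hcomm hL hR
        (fun x y => by simp [e, hn]) (by rw [comp_assoc, h, comp_assoc])
      ext x
      exact (MulOpposite.opLinearEquiv k).injective (LinearMap.congr_fun hop x)

/-- The antipode of a finite-dimensional weak Hopf algebra is injective. -/
theorem injective : Function.Injective S := by
  obtain ⟨N, hN⟩ := Filter.eventually_atTop.1 S.eventually_isCompl_ker_pow_range_pow
  have hc := (hN (N + 1) N.le_succ).symm
  set F := S ^ (N + 1) with hF
  let p := Submodule.projection _ _ hc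
  have p_mem : ∀ x, p x ∈ LinearMap.range F := fun x => Submodule.projection_apply_mem hc x
  have F_p : ∀ x, F (p x) = F x := by
    intro x
    have h : x - p x ∈ LinearMap.ker F := Submodule.sub_projection_mem hc x
    rw [mem_ker, map_sub, sub_eq_zero] at h
    exact h.symm
  have p_eq : ∀ x y, y ∈ LinearMap.range F → F x = F y → p x = y := by
    intro x y hy hxy
    have h : p (x - y) = 0 := by
      rw [Submodule.projection_apply_eq_zero_iff, mem_ker, map_sub, hxy, sub_self]
    rw [map_sub, sub_eq_zero] at h
    rw [h]
    exact Submodule.projection_apply_left hc ⟨y, hy⟩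
  have hFS : ∀ x, F (S x) = S (F x) := by
    intro x
    rw [hF, ← Module.End.mul_apply, ← Module.End.mul_apply, pow_mul_comm']
  have range_mul : ∀ x y, x ∈ LinearMap.range F → y ∈ LinearMap.range F →
      x * y ∈ LinearMap.range F := by
    rintro _ _ ⟨x, rfl⟩ ⟨y, rfl⟩
    rcases hS.pow_map_mul (N + 1) with h | h
    · exact ⟨x * y, h x y⟩
    · exact ⟨y * x, h y x⟩
  have F_mul : ∀ x y, F (x * y) = F (p x * p y) := by
    intro x y
    rcases hS.pow_map_mul (N + 1) with h | h <;> simp only [← hF] at h <;> rw [h, h, F_p, F_p]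
  have hid : p = LinearMap.id := hS.eq_id_of_pow_comp_eq
    (fun x y => p_eq _ _ (range_mul _ _ (p_mem x) (p_mem y)) (F_mul x y))
    (LinearMap.ext fun x => p_eq _ _
      (by
        obtain ⟨y, hy⟩ := p_mem x
        exact ⟨S y, by rw [hFS, hy, comp_apply]⟩)
      (by rw [comp_apply, hFS, hFS, F_p]))
    (LinearMap.ext fun x => p_eq _ _ (hS.projL_projR_mem_range_pow _ x).1 rfl)
    (LinearMap.ext fun x => p_eq _ _ (hS.projL_projR_mem_range_pow _ x).2 rfl)
    (N + 1) (LinearMap.ext F_p)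
  rw [LinearMap.injective_iff_surjective]
  intro x
  obtain ⟨y, hy⟩ := p_mem x
  rw [hid, id_apply, hF, pow_succ', Module.End.mul_apply] at hy
  exact ⟨_, hy⟩

/-- There is a skew antipode: a linear map `T` with `T(x₍₂₎)x₍₁₎ = Π̄^R(x)`. -/
theorem exists_skew_antipode : ∃ T : H →ₗ[k] H, ∀ x, LinearMap.mul' k H
    (rTensor H T (TensorProduct.comm k H H (wb.comul x))) = wb.projBarR x := by
  let e := LinearEquiv.ofInjectiveEndo S hS.injective
  have hST : ∀ x, S (e.symm x) = x := e.apply_symm_apply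
  have key : ∀ w : H ⊗[k] H, S (LinearMap.mul' k H
      (rTensor H e.symm.toLinearMap (TensorProduct.comm k H H w))) =
        LinearMap.mul' k H (rTensor H S w) := by
    intro w
    induction w with
    | zero => simp
    | add z w hz hw => simp only [map_add, hz, hw]
    | tmul a b => simp [hS.map_mul, hST]
  refine ⟨e.symm.toLinearMap, fun x => hS.injective ?_⟩
  rw [key, hS.antipode_left, hS.antipode_projBarR]

end WeakBialgebra.IsAntipode

/-- Coordinates along a basis of `H` identify `A ⊗ H` with `A^n` as `A`-`A`-bimodules. -/
theorem exists_coordEquiv (k : Type*) [Field k] (H : Type*) [Ring H] [Algebra k H]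
    [FiniteDimensional k H] (A : Type*) [Ring A] [Algebra k A] :
    ∃ E : A ⊗[k] H ≃ₗ[k] (Fin (Module.finrank k H) → A),
      (∀ (c : A) (w : A ⊗[k] H), E (c ⊗ₜ[k] (1 : H) * w) = fun i => c * E w i) ∧
      (∀ (c : A) (w : A ⊗[k] H), E (w * c ⊗ₜ[k] (1 : H)) = fun i => E w i * c) := by
  refine ⟨TensorProduct.congr (LinearEquiv.refl k A) (Module.finBasis k H).equivFun ≪≫ₗ
    TensorProduct.piScalarRight k k A _, fun c w => funext fun i => ?_,
    fun c w => funext fun i => ?_⟩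
  · induction w with
    | zero => simp
    | add z w hz hw => simp only [map_add, mul_add, Pi.add_apply, hz, hw]
    | tmul a h => simp
  · induction w with
    | zero => simp
    | add z w hz hw => simp only [map_add, add_mul, Pi.add_apply, hz, hw]
    | tmul a h => simp

namespace ComodAlg

variable {k : Type*} [Field k] {H : Type*} [Ring H] [Algebra k H] [FiniteDimensional k H]
  {wb : WeakBialgebra k H} {A : Type*} [Ring A] [Algebra k A] (ca : ComodAlg wb A)

theorem ρ_one_mul_ρ (a : A) : ca.ρ 1 * ca.ρ a = ca.ρ a := by rw [← ca.mul, one_mul]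

theorem ρ_mul_ρ_one (a : A) : ca.ρ a * ca.ρ 1 = ca.ρ a := by rw [← ca.mul, mul_one]

variable {ca}

/-- `ρ(b) = b1₍₀₎ ⊗ 1₍₁₎` for a coinvariant `b`. -/
theorem ρ_eq_tmul_mul {b : A} (hb : b ∈ ca.coinv) : ca.ρ b = b ⊗ₜ[k] (1 : H) * ca.ρ 1 := by
  have key : ∀ w : A ⊗[k] H, lTensor A wb.projBarR (w * b ⊗ₜ[k] (1 : H)) =
      lTensor A wb.projBarR w * b ⊗ₜ[k] (1 : H) := by
    intro w
    induction w with
    | zero => simp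
    | add z w hz hw => simp only [map_add, add_mul, hz, hw]
    | tmul a h => simp
  have hb' : ca.ρ b = ca.ρ 1 * b ⊗ₜ[k] (1 : H) := hb
  rw [← ca.pibarR, hb', key, ca.pibarR, ← Algebra.TensorProduct.one_def, one_mul]

theorem ρ_coinv_mul {b : A} (hb : b ∈ ca.coinv) (a : A) :
    ca.ρ (b * a) = b ⊗ₜ[k] (1 : H) * ca.ρ a := by
  rw [ca.mul, ρ_eq_tmul_mul hb, mul_assoc, ρ_one_mul_ρ]

theorem ρ_mul_coinv {b : A} (hb : b ∈ ca.coinv) (a : A) :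
    ca.ρ (a * b) = ca.ρ a * b ⊗ₜ[k] (1 : H) := by
  have hb' : ca.ρ b = ca.ρ 1 * b ⊗ₜ[k] (1 : H) := hb
  rw [ca.mul, hb', ← mul_assoc, ρ_mul_ρ_one]

variable (ca)

theorem mkA_surjective : Function.Surjective ca.mkA := ca.rel.mkQ_surjective

@[simp]
theorem lmulA_mkA (c a a' : A) : ca.lmulA c (ca.mkA (a ⊗ₜ[k] a')) = ca.mkA ((c * a) ⊗ₜ[k] a') :=
  rfl

@[simp]
theorem rmulA_mkA (c a a' : A) : ca.rmulA c (ca.mkA (a ⊗ₜ[k] a')) = ca.mkA (a ⊗ₜ[k] (a' * c)) :=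
  rfl

section Galois

variable {ca} {β : ca.QA →ₗ[k] A ⊗[k] H}
  (hβ : ∀ a a' : A, β (ca.mkA (a ⊗ₜ[k] a')) = (a ⊗ₜ[k] (1 : H)) * ca.ρ a')
include hβ

theorem galois_lmulA (c : A) (q : ca.QA) : β (ca.lmulA c q) = c ⊗ₜ[k] (1 : H) * β q := by
  obtain ⟨w, rfl⟩ := ca.mkA_surjective q
  induction w with
  | zero => simp
  | add z w hz hw => simp only [map_add, mul_add, hz, hw]
  | tmul a a' => rw [lmulA_mkA, hβ, hβ, ← mul_assoc]; simp

theorem galois_rmulA (c : A) (q : ca.QA) : β (ca.rmulA c q) = β q * ca.ρ c := by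
  obtain ⟨w, rfl⟩ := ca.mkA_surjective q
  induction w with
  | zero => simp
  | add z w hz hw => simp only [map_add, add_mul, hz, hw]
  | tmul a a' => rw [rmulA_mkA, hβ, hβ, ca.mul, mul_assoc]

theorem galois_mul_ρ_one (q : ca.QA) : β q * ca.ρ 1 = β q := by
  obtain ⟨w, rfl⟩ := ca.mkA_surjective q
  induction w with
  | zero => simp
  | add z w hz hw => simp only [map_add, add_mul, hz, hw]
  | tmul a a' => rw [hβ, mul_assoc, ρ_mul_ρ_one]

theorem galois_rmulA_coinv {b : A} (hb : b ∈ ca.coinv) (q : ca.QA) :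
    β (ca.rmulA b q) = β q * b ⊗ₜ[k] (1 : H) := by
  have hb' : ca.ρ b = ca.ρ 1 * b ⊗ₜ[k] (1 : H) := hb
  rw [galois_rmulA hβ, hb', ← mul_assoc, galois_mul_ρ_one hβ]

end Galois

/-- The map `A ⊗_B A → A ⊗ H`, `a ⊗ a' ↦ a₍₀₎a' ⊗ a₍₁₎`. -/
def leftGalois : ca.QA →ₗ[k] A ⊗[k] H :=
  ca.rel.liftQ
    (LinearMap.mul' k (A ⊗[k] H) ∘ₗ TensorProduct.map ca.ρ ((TensorProduct.mk k A H).flip 1)) <| by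
    rw [rel, Submodule.span_le]
    rintro _ ⟨a, a', b, hb, rfl⟩
    simp [ρ_mul_coinv hb, mul_assoc]

@[simp]
theorem leftGalois_mkA (a a' : A) :
    ca.leftGalois (ca.mkA (a ⊗ₜ[k] a')) = ca.ρ a * a' ⊗ₜ[k] (1 : H) := rfl

theorem leftGalois_rmulA (c : A) (q : ca.QA) :
    ca.leftGalois (ca.rmulA c q) = ca.leftGalois q * c ⊗ₜ[k] (1 : H) := by
  obtain ⟨w, rfl⟩ := ca.mkA_surjective q
  induction w with
  | zero => simp
  | add z w hz hw => simp only [map_add, add_mul, hz, hw]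
  | tmul a a' => simp [mul_assoc]

theorem leftGalois_lmulA_coinv {b : A} (hb : b ∈ ca.coinv) (q : ca.QA) :
    ca.leftGalois (ca.lmulA b q) = b ⊗ₜ[k] (1 : H) * ca.leftGalois q := by
  obtain ⟨w, rfl⟩ := ca.mkA_surjective q
  induction w with
  | zero => simp
  | add z w hz hw => simp only [map_add, mul_add, hz, hw]
  | tmul a a' => simp [ρ_coinv_mul hb, mul_assoc]

/-- The twist `a ⊗ h ↦ a₍₀₎ ⊗ T(h)a₍₁₎` of `A ⊗ H` along a linear map `T`. -/
def twist (T : H →ₗ[k] H) : A ⊗[k] H →ₗ[k] A ⊗[k] H :=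
  LinearMap.mul' k (A ⊗[k] H) ∘ₗ TensorProduct.map (TensorProduct.mk k A H 1 ∘ₗ T) ca.ρ ∘ₗ
    (TensorProduct.comm k A H).toLinearMap

variable (T : H →ₗ[k] H)

@[simp]
theorem twist_tmul (a : A) (h : H) : ca.twist T (a ⊗ₜ[k] h) = (1 : A) ⊗ₜ[k] T h * ca.ρ a := rfl

theorem twist_mul_tmul (c : A) (w : A ⊗[k] H) :
    ca.twist T (w * c ⊗ₜ[k] (1 : H)) = ca.twist T w * ca.ρ c := by
  induction w with
  | zero => simp
  | add z w hz hw => simp only [map_add, add_mul, hz, hw]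
  | tmul a h => simp [ca.mul, mul_assoc]

theorem twist_tmul_mul {b : A} (hb : b ∈ ca.coinv) (w : A ⊗[k] H) :
    ca.twist T (b ⊗ₜ[k] (1 : H) * w) = b ⊗ₜ[k] (1 : H) * ca.twist T w := by
  induction w with
  | zero => simp
  | add z w hz hw => simp only [map_add, mul_add, hz, hw]
  | tmul a h => simp [ρ_coinv_mul hb, ← mul_assoc]

theorem twist_mul_ρ_one (w : A ⊗[k] H) : ca.twist T w * ca.ρ 1 = ca.twist T w := by
  rw [← twist_mul_tmul, ← Algebra.TensorProduct.one_def, mul_one]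

variable {T}

theorem twist_leftGalois (hT : ∀ x, LinearMap.mul' k H
      (rTensor H T (TensorProduct.comm k H H (wb.comul x))) = wb.projBarR x) (a a' : A) :
    ca.twist T (ca.leftGalois (ca.mkA (a ⊗ₜ[k] a'))) = a ⊗ₜ[k] (1 : H) * ca.ρ a' := by
  let N : H ⊗[k] H →ₗ[k] H :=
    LinearMap.mul' k H ∘ₗ rTensor H T ∘ₗ (TensorProduct.comm k H H).toLinearMap
  have aux : ∀ (u : A ⊗[k] H) (h : H),
      lTensor A N (TensorProduct.assoc k A H H (u ⊗ₜ[k] h)) = (1 : A) ⊗ₜ[k] T h * u := by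
    intro u h
    induction u with
    | zero => simp
    | add z w hz hw => simp only [map_add, add_tmul, mul_add, hz, hw]
    | tmul a h => simp [N]
  have key : ∀ w : A ⊗[k] H,
      ca.twist T w = lTensor A N (TensorProduct.assoc k A H H (rTensor H ca.ρ w)) := by
    intro w
    induction w with
    | zero => simp
    | add z w hz hw => simp only [map_add, hz, hw]
    | tmul a h => simp [aux]
  have hN : N ∘ₗ wb.comul = wb.projBarR := LinearMap.ext hT
  rw [leftGalois_mkA, twist_mul_tmul, key, ca.coassoc, ← comp_apply, ← lTensor_comp, hN,
    ca.pibarR, mul_assoc, ρ_one_mul_ρ]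

end ComodAlg

/-- A linear map with values in the range of an injective linear map factors through it. -/
theorem exists_comp_eq_of_injective {k V W U : Type*} [Field k] [AddCommGroup V] [Module k V]
    [AddCommGroup W] [Module k W] [AddCommGroup U] [Module k U] {β : V →ₗ[k] W}
    (hinj : Function.Injective β) (φ : U →ₗ[k] W) (hφ : ∀ u, φ u ∈ Set.range β) :
    ∃ γ : U →ₗ[k] V, ∀ u, β (γ u) = φ u := by
  refine ⟨(LinearEquiv.ofInjective β hinj).symm.toLinearMap ∘ₗ φ.codRestrict _ hφ, fun u => ?_⟩
  exact congrArg Subtype.val ((LinearEquiv.ofInjective β hinj).apply_symm_apply ⟨φ u, hφ u⟩)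

/-- a weak `H`-Galois extension `A | B` is left and right depth two: with
`n = dim_k H`, the `A`-`B`-bimodule `A ⊗_B A` is isomorphic to a direct summand of `A^n`,
and likewise as `B`-`A`-bimodules. -/
theorem statement13 {k : Type*} [Field k] {H : Type*} [Ring H] [Algebra k H]
    [FiniteDimensional k H] (wb : WeakBialgebra k H) (S : H →ₗ[k] H) (hS : wb.IsAntipode S)
    {A : Type*} [Ring A] [Algebra k A] (ca : ComodAlg wb A)
    (β : ca.QA →ₗ[k] A ⊗[k] H)
    (hβ : ∀ a a' : A, β (ca.mkA (a ⊗ₜ[k] a')) = (a ⊗ₜ[k] (1 : H)) * ca.ρ a')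
    (hinj : Function.Injective β)
    (hrange : Set.range ⇑β = Set.range (fun w : A ⊗[k] H => w * ca.ρ 1)) :
    -- right D2: `A ⊗_B A` is a direct summand of `A^n` as `A`-`B`-bimodules
    (∃ (f : ca.QA →ₗ[k] (Fin (Module.finrank k H) → A))
       (g : (Fin (Module.finrank k H) → A) →ₗ[k] ca.QA),
      (∀ (c : A) (q : ca.QA), f (ca.lmulA c q) = fun i => c * f q i) ∧
      (∀ b ∈ ca.coinv, ∀ q : ca.QA, f (ca.rmulA b q) = fun i => f q i * b) ∧
      (∀ (c : A) (v : Fin (Module.finrank k H) → A),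
        g (fun i => c * v i) = ca.lmulA c (g v)) ∧
      (∀ b ∈ ca.coinv, ∀ v : Fin (Module.finrank k H) → A,
        g (fun i => v i * b) = ca.rmulA b (g v)) ∧
      (∀ q : ca.QA, g (f q) = q)) ∧
    -- left D2: `A ⊗_B A` is a direct summand of `A^n` as `B`-`A`-bimodules
    (∃ (f : ca.QA →ₗ[k] (Fin (Module.finrank k H) → A))
       (g : (Fin (Module.finrank k H) → A) →ₗ[k] ca.QA),
      (∀ (c : A) (q : ca.QA), f (ca.rmulA c q) = fun i => f q i * c) ∧
      (∀ b ∈ ca.coinv, ∀ q : ca.QA, f (ca.lmulA b q) = fun i => b * f q i) ∧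
      (∀ (c : A) (v : Fin (Module.finrank k H) → A),
        g (fun i => v i * c) = ca.rmulA c (g v)) ∧
      (∀ b ∈ ca.coinv, ∀ v : Fin (Module.finrank k H) → A,
        g (fun i => b * v i) = ca.lmulA b (g v)) ∧
      (∀ q : ca.QA, g (f q) = q)) := by
  obtain ⟨E, hEl, hEr⟩ := exists_coordEquiv k H A
  have hEl' : ∀ (c : A) (v : Fin (Module.finrank k H) → A),
      E.symm (fun i => c * v i) = c ⊗ₜ[k] (1 : H) * E.symm v := by
    intro c v
    rw [LinearEquiv.symm_apply_eq, hEl, LinearEquiv.apply_symm_apply]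
  have hEr' : ∀ (c : A) (v : Fin (Module.finrank k H) → A),
      E.symm (fun i => v i * c) = E.symm v * c ⊗ₜ[k] (1 : H) := by
    intro c v
    rw [LinearEquiv.symm_apply_eq, hEr, LinearEquiv.apply_symm_apply]
  constructor
  · obtain ⟨γ, hγ⟩ := exists_comp_eq_of_injective hinj (mulRight k (ca.ρ 1))
      fun w => hrange ▸ ⟨w, rfl⟩
    simp only [mulRight_apply] at hγ
    refine ⟨E.toLinearMap ∘ₗ β, γ ∘ₗ E.symm.toLinearMap, fun c q => ?_, fun b hb q => ?_,
      fun c v => hinj ?_, fun b hb v => hinj ?_, fun q => hinj ?_⟩ <;>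
      simp only [comp_apply, LinearEquiv.coe_coe]
    · rw [ComodAlg.galois_lmulA hβ, hEl]
    · rw [ComodAlg.galois_rmulA_coinv hβ hb, hEr]
    · rw [ComodAlg.galois_lmulA hβ, hγ, hγ, hEl', mul_assoc]
    · rw [ComodAlg.galois_rmulA hβ, hγ, hγ, hEr', mul_assoc, mul_assoc, ComodAlg.ρ_one_mul_ρ,
        ComodAlg.ρ_eq_tmul_mul hb]
    · rw [hγ, LinearEquiv.symm_apply_apply, ComodAlg.galois_mul_ρ_one hβ]
  · obtain ⟨T, hT⟩ := hS.exists_skew_antipode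
    obtain ⟨γ, hγ⟩ := exists_comp_eq_of_injective hinj (ca.twist T)
      fun w => hrange ▸ ⟨_, ca.twist_mul_ρ_one T w⟩
    have htwist : ∀ q, ca.twist T (ca.leftGalois q) = β q := by
      intro q
      obtain ⟨w, rfl⟩ := ca.mkA_surjective q
      induction w with
      | zero => simp
      | add z w hz hw => simp only [map_add, hz, hw]
      | tmul a a' => rw [ca.twist_leftGalois hT, hβ]
    refine ⟨E.toLinearMap ∘ₗ ca.leftGalois, γ ∘ₗ E.symm.toLinearMap, fun c q => ?_,
      fun b hb q => ?_, fun c v => hinj ?_, fun b hb v => hinj ?_, fun q => hinj ?_⟩ <;>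
      simp only [comp_apply, LinearEquiv.coe_coe]
    · rw [ca.leftGalois_rmulA, hEr]
    · rw [ca.leftGalois_lmulA_coinv hb, hEl]
    · rw [ComodAlg.galois_rmulA hβ, hγ, hγ, hEr', ca.twist_mul_tmul]
    · rw [ComodAlg.galois_lmulA hβ, hγ, hγ, hEl', ca.twist_tmul_mul T hb]
    · rw [hγ, LinearEquiv.symm_apply_apply, htwist]
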